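/- Let d be a positive integer, ζ ∈ ℂ a primitive d-th root of unity, and let G be a subgroup of GL₂(ℂ) with ζ·I₂ ∈ G and det(g)^d = 1 for every g ∈ G. Then the subgroup D_d of GL₄(ℂ) generated by (ζ·I₂)^∨ and s is a normal subgroup of the subgroup of GL₄(ℂ) generated by {g^∨ : g ∈ G} and s. -/

import Mathlib

open Matrix

/-- For a 2×2 matrix `g`, the block-diagonal 4×4 matrix `g^∨ = diag(g, (gᵀ)⁻¹)`. -/
noncomputable def vee (g : Matrix (Fin 2) (Fin 2) ℂ) : Matrix (Fin 4) (Fin 4) ℂ :=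
  (Matrix.fromBlocks g 0 0 gᵀ⁻¹).submatrix
    ⇑(finSumFinEquiv (m := 2) (n := 2)).symm ⇑(finSumFinEquiv (m := 2) (n := 2)).symm

/-- The matrix `s`, with `s₁₄ = s₄₁ = 1`, `s₂₃ = s₃₂ = -1` and all other entries `0`. -/
def sMat : Matrix (Fin 4) (Fin 4) ℂ :=
  !![0,0,0,1; 0,0,-1,0; 0,-1,0,0; 1,0,0,0]

lemma vee_det_ne_zero (g : GL (Fin 2) ℂ) : (vee (g : Matrix (Fin 2) (Fin 2) ℂ)).det ≠ 0 := by
  have hu : IsUnit ((g : Matrix (Fin 2) (Fin 2) ℂ).det) :=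
    (Matrix.isUnit_iff_isUnit_det _).mp ⟨g, rfl⟩
  unfold vee
  rw [Matrix.det_submatrix_equiv_self, Matrix.det_fromBlocks_zero₂₁,
    Matrix.det_nonsing_inv, Matrix.det_transpose]
  exact mul_ne_zero hu.ne_zero (by simp [Ring.inverse_eq_inv', inv_ne_zero hu.ne_zero])

lemma sMat_mul_sMat : sMat * sMat = 1 := by
  ext i j
  fin_cases i <;> fin_cases j <;>
    simp [sMat, Matrix.mul_apply, Fin.sum_univ_succ, Matrix.one_apply]

/-- `g^∨` as an element of `GL₄(ℂ)`. -/
noncomputable def veeGL (g : GL (Fin 2) ℂ) : GL (Fin 4) ℂ :=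
  Matrix.GeneralLinearGroup.mkOfDetNeZero (vee (g : Matrix (Fin 2) (Fin 2) ℂ))
    (vee_det_ne_zero g)

/-- `s` as an element of `GL₄(ℂ)`. -/
def sGL : GL (Fin 4) ℂ :=
  ⟨sMat, sMat, sMat_mul_sMat, sMat_mul_sMat⟩

/-- The scalar matrix `z • I₂` as an element of `GL₂(ℂ)`. -/
noncomputable def scalarGL (z : ℂˣ) : GL (Fin 2) ℂ :=
  Units.map (Matrix.scalar (Fin 2)).toMonoidHom z

lemma vee_mul (g h : GL (Fin 2) ℂ) :
    vee ((g * h : GL (Fin 2) ℂ) : Matrix (Fin 2) (Fin 2) ℂ) = vee g * vee h := by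
  simp only [vee, Matrix.submatrix_mul_equiv, Matrix.fromBlocks_multiply, Units.val_mul,
    Matrix.transpose_mul, Matrix.mul_inv_rev]
  simp

/-- The map `g ↦ g^∨` as a group homomorphism. -/
noncomputable def veeHom : GL (Fin 2) ℂ →* GL (Fin 4) ℂ :=
  MonoidHom.mk' veeGL fun g h => Units.ext (vee_mul g h)

lemma veeGL_inv (g : GL (Fin 2) ℂ) : veeGL g⁻¹ = (veeGL g)⁻¹ :=
  map_inv veeHom g

lemma veeGL_mul (g h : GL (Fin 2) ℂ) : veeGL (g * h) = veeGL g * veeGL h :=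
  map_mul veeHom g h

lemma veeGL_scalarGL_pow (z : ℂˣ) (k : ℕ) :
    veeGL (scalarGL (z ^ k)) = veeGL (scalarGL z) ^ k := by
  rw [scalarGL, map_pow]
  exact map_pow veeHom (scalarGL z) k

lemma commute_scalarGL (g : GL (Fin 2) ℂ) (z : ℂˣ) : g * scalarGL z = scalarGL z * g :=
  Units.ext (Matrix.scalar_commute (z : ℂ) (Commute.all _)
    (g : Matrix (Fin 2) (Fin 2) ℂ)).symm.eq

lemma vee_eq (g : Matrix (Fin 2) (Fin 2) ℂ) :
    vee g = !![g 0 0, g 0 1, 0, 0; g 1 0, g 1 1, 0, 0;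
      0, 0, g.det⁻¹ * g 1 1, -(g.det⁻¹ * g 1 0); 0, 0, -(g.det⁻¹ * g 0 1), g.det⁻¹ * g 0 0] := by
  have e0 : (finSumFinEquiv (m := 2) (n := 2)).symm 0 = Sum.inl 0 := rfl
  have e1 : (finSumFinEquiv (m := 2) (n := 2)).symm 1 = Sum.inl 1 := rfl
  have e2 : (finSumFinEquiv (m := 2) (n := 2)).symm 2 = Sum.inr 0 := rfl
  have e3 : (finSumFinEquiv (m := 2) (n := 2)).symm 3 = Sum.inr 1 := rfl
  rw [vee, Matrix.inv_def, Matrix.det_transpose, Matrix.adjugate_fin_two]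
  ext i j
  fin_cases i <;> fin_cases j <;> simp [e0, e1, e2, e3]

lemma veeGL_mul_sGL (g : GL (Fin 2) ℂ) :
    veeGL g * sGL = veeGL (scalarGL (Matrix.GeneralLinearGroup.det g)) * sGL * veeGL g := by
  have hg : (g : Matrix (Fin 2) (Fin 2) ℂ).det ≠ 0 := g.det_ne_zero
  have key : vee g * sMat =
      vee (Matrix.scalar (Fin 2) (g : Matrix (Fin 2) (Fin 2) ℂ).det) * sMat * vee g := by
    rw [vee_eq, vee_eq]
    generalize hD : (g : Matrix (Fin 2) (Fin 2) ℂ).det = D at *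
    ext i j
    fin_cases i <;> fin_cases j <;>
      simp [sMat, Matrix.mul_apply, Fin.sum_univ_four] <;> field_simp <;> simp
  exact Units.ext key

lemma veeGL_conj_sGL (g : GL (Fin 2) ℂ) :
    veeGL g * sGL * (veeGL g)⁻¹ = veeGL (scalarGL (Matrix.GeneralLinearGroup.det g)) * sGL := by
  rw [veeGL_mul_sGL, mul_inv_cancel_right]

lemma veeGL_conj_scalarGL (g : GL (Fin 2) ℂ) (z : ℂˣ) :
    veeGL g * veeGL (scalarGL z) * (veeGL g)⁻¹ = veeGL (scalarGL z) := by
  rw [← veeGL_mul, commute_scalarGL, veeGL_mul, mul_inv_cancel_right]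

/-- Conjugation by `a` preserves the subgroup generated by `S` once it maps `S` into it. -/
lemma Subgroup.conj_mem_closure {M : Type*} [Group M] {S : Set M} {a : M}
    (ha : ∀ x ∈ S, a * x * a⁻¹ ∈ Subgroup.closure S) {x : M} (hx : x ∈ Subgroup.closure S) :
    a * x * a⁻¹ ∈ Subgroup.closure S :=
  (Subgroup.closure_le ((Subgroup.closure S).comap (MulAut.conj a).toMonoidHom)).2 ha hx

/-- Let `ζ` be a primitive `d`-th root of unity and `G ≤ GL₂(ℂ)` with `ζ • I₂ ∈ G` and
`det(g)^d = 1` for all `g ∈ G`.  Then `D_d = ⟨(ζ • I₂)^∨, s⟩` is a normal subgroup of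
the subgroup of `GL₄(ℂ)` generated by `{g^∨ : g ∈ G}` and `s`. -/
theorem Dd_normal (d : ℕ) (hd : 0 < d) (ζ : ℂˣ) (hζ : IsPrimitiveRoot (ζ : ℂ) d)
    (G : Subgroup (GL (Fin 2) ℂ)) (hζG : scalarGL ζ ∈ G)
    (hdet : ∀ g ∈ G, ((g : Matrix (Fin 2) (Fin 2) ℂ).det) ^ d = 1) :
    Subgroup.closure {veeGL (scalarGL ζ), sGL}
       ≤ Subgroup.closure (veeGL '' (G : Set (GL (Fin 2) ℂ)) ∪ {sGL}) ∧
    ∀ h ∈ Subgroup.closure (veeGL '' (G : Set (GL (Fin 2) ℂ)) ∪ {sGL}),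
      ∀ x ∈ Subgroup.closure {veeGL (scalarGL ζ), sGL},
        h * x * h⁻¹ ∈ Subgroup.closure {veeGL (scalarGL ζ), sGL} := by
  have hv : veeGL (scalarGL ζ) ∈ Subgroup.closure {veeGL (scalarGL ζ), sGL} :=
    Subgroup.subset_closure (by simp)
  have hs : sGL ∈ Subgroup.closure {veeGL (scalarGL ζ), sGL} :=
    Subgroup.subset_closure (by simp)
  have conj_vee : ∀ g ∈ G, ∀ x ∈ Subgroup.closure {veeGL (scalarGL ζ), sGL},
      veeGL g * x * (veeGL g)⁻¹ ∈ Subgroup.closure {veeGL (scalarGL ζ), sGL} := by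
    intro g hg x hx
    refine Subgroup.conj_mem_closure ?_ hx
    rintro y (rfl | rfl)
    · rwa [veeGL_conj_scalarGL]
    · have : NeZero d := ⟨hd.ne'⟩
      obtain ⟨k, -, hk⟩ := hζ.eq_pow_of_pow_eq_one (hdet g hg)
      have hk' : Matrix.GeneralLinearGroup.det g = ζ ^ k := Units.ext (by simpa using hk.symm)
      rw [veeGL_conj_sGL, hk', veeGL_scalarGL_pow]
      exact mul_mem (pow_mem hv k) hs
  constructor
  · rw [Subgroup.closure_le]
    rintro y (rfl | rfl)
    · exact Subgroup.subset_closure (Or.inl ⟨_, hζG, rfl⟩)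
    · exact Subgroup.subset_closure (Or.inr rfl)
  · intro h hh
    induction hh using Subgroup.closure_induction'' with
    | mem y hy =>
      rcases hy with ⟨g, hg, rfl⟩ | rfl
      · exact conj_vee g hg
      · exact fun x hx => mul_mem (mul_mem hs hx) (inv_mem hs)
    | inv_mem y hy =>
      rcases hy with ⟨g, hg, rfl⟩ | rfl
      · rw [← veeGL_inv]
        exact conj_vee g⁻¹ (inv_mem hg)
      · exact fun x hx => mul_mem (mul_mem (inv_mem hs) hx) (inv_mem (inv_mem hs))
    | one => intro x hx; simpa using hx
    | mul a b _ _ iha ihb =>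
      intro x hx
      simpa [mul_assoc] using iha _ (ihb x hx)
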